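/- Lemma 1 (weight of products of block restrictions): In the GCQC setup, let 1 ≤ i ≤ j ≤ m, let w ∈ L_i and v ∈ L_j, let r, s ∈ {1,…,N}, and let p ∈ (V_n)^N be the vector whose r-th block is w and whose s-th block is v (with w + v in that block if r = s), all other blocks being zero. If p ≠ 0, then swt(p) ≥ d_i. -/

import Mathlib

open Finset

/-- Pauli operators (up to phase) on `n` qubits, as symplectic vectors. -/
abbrev Pauli (n : ℕ) := Fin n → (ZMod 2) × (ZMod 2)

/-- The outer space `W = (𝔽₂^r × 𝔽₂^r)^N`. -/
abbrev Outer (r N : ℕ) := Fin N → (Fin r → ZMod 2) × (Fin r → ZMod 2)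

/-- `N` blocks of `n` qubits each. -/
abbrev PauliB (n N : ℕ) := Fin N → Pauli n

/-- Elementary symplectic form on one qubit. -/
def B0 : LinearMap.BilinForm (ZMod 2) ((ZMod 2) × (ZMod 2)) :=
  LinearMap.mk₂ (ZMod 2) (fun u v => u.1 * v.2 + v.1 * u.2)
    (fun a b v => by simp; ring)
    (fun c a v => by simp; ring)
    (fun a b v => by simp; ring)
    (fun c a v => by simp; ring)

/-- Sum of a bilinear form over `N` coordinates. -/
def sumForm {M : Type*} [AddCommGroup M] [Module (ZMod 2) M] (N : ℕ)
    (B : LinearMap.BilinForm (ZMod 2) M) :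
    LinearMap.BilinForm (ZMod 2) (Fin N → M) :=
  LinearMap.mk₂ (ZMod 2) (fun u v => ∑ j, B (u j) (v j))
    (fun a b v => by simp [Finset.sum_add_distrib])
    (fun c a v => by simp [Finset.mul_sum])
    (fun a b v => by simp [Finset.sum_add_distrib])
    (fun c a v => by simp [Finset.mul_sum])

/-- Symplectic form on `r`-qubit blocks written as pairs of binary `r`-vectors. -/
def pairForm (r : ℕ) : LinearMap.BilinForm (ZMod 2) ((Fin r → ZMod 2) × (Fin r → ZMod 2)) :=
  LinearMap.mk₂ (ZMod 2) (fun u v => ∑ ℓ, (u.1 ℓ * v.2 ℓ + v.1 ℓ * u.2 ℓ))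
    (fun a b v => by rw [← Finset.sum_add_distrib]; refine Finset.sum_congr rfl fun ℓ _ => by simp; ring)
    (fun c a v => by rw [smul_eq_mul, Finset.mul_sum]; refine Finset.sum_congr rfl fun ℓ _ => by simp; ring)
    (fun a b v => by rw [← Finset.sum_add_distrib]; refine Finset.sum_congr rfl fun ℓ _ => by simp; ring)
    (fun c a v => by rw [smul_eq_mul, Finset.mul_sum]; refine Finset.sum_congr rfl fun ℓ _ => by simp; ring)

/-- Symplectic form on `Pauli n`. -/
def symplF (n : ℕ) : LinearMap.BilinForm (ZMod 2) (Pauli n) := sumForm n B0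

/-- Symplectic form on `N` blocks of `n` qubits. -/
def symplFB (n N : ℕ) : LinearMap.BilinForm (ZMod 2) (PauliB n N) := sumForm N (symplF n)

/-- Symplectic form on the outer space `W_i`. -/
def symplFO (r N : ℕ) : LinearMap.BilinForm (ZMod 2) (Outer r N) := sumForm N (pairForm r)

/-- Orthogonal complement of a subspace w.r.t. a bilinear form. -/
def perp {M : Type*} [AddCommGroup M] [Module (ZMod 2) M]
    (B : LinearMap.BilinForm (ZMod 2) M) (S : Submodule (ZMod 2) M) :
    Submodule (ZMod 2) M where
  carrier := {v | ∀ s ∈ S, B s v = 0}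
  add_mem' := fun hu hv s hs => by
    rw [map_add, hu s hs, hv s hs, add_zero]
  zero_mem' := fun s hs => by simp
  smul_mem' := fun c v hv s hs => by
    rw [map_smul, hv s hs, smul_zero]

/-- Generic weight: number of nonzero coordinates. -/
def wgt {N : ℕ} {M : Type*} [Zero M] [DecidableEq M] (v : Fin N → M) : ℕ :=
  (Finset.univ.filter fun j => v j ≠ 0).card

/-- Symplectic weight on `N` blocks of `n` qubits: number of nonzero qubit positions. -/
def swtB {n N : ℕ} (v : PauliB n N) : ℕ := ∑ j, wgt (v j)

/-- Stabilizer of the subcode `B_i`: `S` together with the logical `z`'s of index `< kk`. -/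
def Sstab (n : ℕ) (S : Submodule (ZMod 2) (Pauli n)) (z : ℕ → Pauli n) (kk : ℕ) :
    Submodule (ZMod 2) (Pauli n) :=
  S ⊔ Submodule.span (ZMod 2) (z '' Set.Iio kk)

/-- Span of the logical operators `x_t, z_t` with `a ≤ t < b` (0-based indexing). -/
def Lspan (n : ℕ) (x z : ℕ → Pauli n) (a b : ℕ) : Submodule (ZMod 2) (Pauli n) :=
  Submodule.span (ZMod 2) ((x '' Set.Ico a b) ∪ (z '' Set.Ico a b))

/-- The block-wise inner stabilizer `S_I`. -/
def SI (n N : ℕ) (S : Submodule (ZMod 2) (Pauli n)) : Submodule (ZMod 2) (PauliB n N) :=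
  Submodule.pi (Set.univ : Set (Fin N)) (fun _ => S)

/-- The replacement map `φ` with offset `off`, sending the `ℓ`-th binary coordinates of each
block to the logical operators `x (off+ℓ)`, `z (off+ℓ)` of the inner code. -/
def phi (n N : ℕ) (x z : ℕ → Pauli n) (off r : ℕ) :
    Outer r N →ₗ[ZMod 2] PauliB n N where
  toFun w := fun j =>
    (∑ ℓ : Fin r, (w j).1 ℓ • x (off + ℓ)) + (∑ ℓ : Fin r, (w j).2 ℓ • z (off + ℓ))
  map_add' := fun a b => by
    funext j
    simp [add_smul, Finset.sum_add_distrib]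
    abel
  map_smul' := fun c a => by
    funext j
    simp [mul_smul, Finset.smul_sum, smul_add]

lemma symplF_comm {n : ℕ} (u v : Pauli n) : symplF n u v = symplF n v u := by
  simp only [symplF, sumForm, B0, LinearMap.mk₂_apply]
  exact Finset.sum_congr rfl fun _ _ => add_comm _ _

lemma Lspan_mono {n : ℕ} (x z : ℕ → Pauli n) {a a' b b' : ℕ} (ha : a' ≤ a) (hb : b ≤ b') :
    Lspan n x z a b ≤ Lspan n x z a' b' :=
  Submodule.span_mono <| Set.union_subset_union
    (Set.image_mono (Set.Ico_subset_Ico ha hb)) (Set.image_mono (Set.Ico_subset_Ico ha hb))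

/-- Logical operators of index at least `a` commute with the stabilizer `Sstab n S z a`. -/
lemma Lspan_le_perp_Sstab {n K : ℕ} {S : Submodule (ZMod 2) (Pauli n)} {x z : ℕ → Pauli n}
    (hxS : ∀ t < K, x t ∈ perp (symplF n) S)
    (hzS : ∀ t < K, z t ∈ perp (symplF n) S)
    (hzz : ∀ s < K, ∀ t < K, symplF n (z s) (z t) = 0)
    (hxz : ∀ s < K, ∀ t < K, symplF n (x s) (z t) = if s = t then 1 else 0) (a : ℕ) :
    Lspan n x z a K ≤ perp (symplF n) (Sstab n S z a) := by
  rw [Lspan, Submodule.span_le]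
  suffices h : ∀ y ∈ perp (symplF n) S,
      (∀ l < a, symplF n (z l) y = 0) → y ∈ perp (symplF n) (Sstab n S z a) by
    rintro _ (⟨t, ht, rfl⟩ | ⟨t, ht, rfl⟩)
    · refine h _ (hxS t ht.2) fun l hl => ?_
      rw [symplF_comm, hxz t ht.2 l (hl.trans_le (ht.1.trans ht.2.le)),
        if_neg (hl.trans_le ht.1).ne']
    · exact h _ (hzS t ht.2) fun l hl =>
        hzz l (hl.trans_le (ht.1.trans ht.2.le)) t ht.2
  intro y hyS hyz
  suffices h : Sstab n S z a ≤ LinearMap.ker ((symplF n).flip y) from fun s hs => h hs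
  refine sup_le hyS (Submodule.span_le.2 ?_)
  rintro _ ⟨l, hl, rfl⟩
  exact hyz l hl

/-- Expansion of a logical operator in the symplectic basis `x t, z t`. -/
lemma eq_sum_of_mem_Lspan {n K : ℕ} {x z : ℕ → Pauli n}
    (hxx : ∀ s < K, ∀ t < K, symplF n (x s) (x t) = 0)
    (hzz : ∀ s < K, ∀ t < K, symplF n (z s) (z t) = 0)
    (hxz : ∀ s < K, ∀ t < K, symplF n (x s) (z t) = if s = t then 1 else 0)
    {a : ℕ} {u : Pauli n} (hu : u ∈ Lspan n x z a K) :
    u = ∑ t ∈ Ico a K, (symplF n u (z t) • x t + symplF n u (x t) • z t) := by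
  induction hu using Submodule.span_induction with
  | mem y hy =>
    rcases hy with ⟨l, hl, rfl⟩ | ⟨l, hl, rfl⟩
    · rw [Finset.sum_eq_single_of_mem l (Finset.mem_Ico.2 hl)]
      · simp [hxz l hl.2 l hl.2, hxx l hl.2 l hl.2]
      · intro t ht hne
        have ht' := (Finset.mem_Ico.1 ht).2
        simp [hxz l hl.2 t ht', hxx l hl.2 t ht', hne.symm]
    · rw [Finset.sum_eq_single_of_mem l (Finset.mem_Ico.2 hl)]
      · simp [symplF_comm (z l) (x l), hxz l hl.2 l hl.2, hzz l hl.2 l hl.2]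
      · intro t ht hne
        have ht' := (Finset.mem_Ico.1 ht).2
        simp [symplF_comm (z l) (x t), hxz t ht' l hl.2, hzz l hl.2 t ht', hne]
  | zero => simp
  | add y y' _ _ hy hy' =>
    nth_rewrite 1 [hy, hy']
    rw [← Finset.sum_add_distrib]
    refine Finset.sum_congr rfl fun t _ => ?_
    simp only [map_add, LinearMap.add_apply, add_smul]
    abel
  | smul c y _ hy =>
    nth_rewrite 1 [hy]
    simp [Finset.smul_sum, mul_smul]

/-- A nonzero logical operator of index at least `a` is not in the stabilizer `Sstab n S z a`. -/
lemma disjoint_Lspan_Sstab {n K : ℕ} {S : Submodule (ZMod 2) (Pauli n)} {x z : ℕ → Pauli n}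
    (hxS : ∀ t < K, x t ∈ perp (symplF n) S)
    (hzS : ∀ t < K, z t ∈ perp (symplF n) S)
    (hxx : ∀ s < K, ∀ t < K, symplF n (x s) (x t) = 0)
    (hzz : ∀ s < K, ∀ t < K, symplF n (z s) (z t) = 0)
    (hxz : ∀ s < K, ∀ t < K, symplF n (x s) (z t) = if s = t then 1 else 0) (a : ℕ) :
    Disjoint (Lspan n x z a K) (Sstab n S z a) := by
  rw [Submodule.disjoint_def]
  intro u hu huS
  have horth := Lspan_le_perp_Sstab hxS hzS hzz hxz a
  rw [eq_sum_of_mem_Lspan hxx hzz hxz hu]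
  refine Finset.sum_eq_zero fun t ht => ?_
  have ht' := Finset.mem_Ico.1 ht
  rw [horth (Submodule.subset_span (Or.inl ⟨t, ht', rfl⟩)) u huS,
    horth (Submodule.subset_span (Or.inr ⟨t, ht', rfl⟩)) u huS]
  simp

lemma wgt_le_swtB {n N : ℕ} (p : PauliB n N) (t : Fin N) : wgt (p t) ≤ swtB p :=
  Finset.single_le_sum (f := fun j => wgt (p j)) (fun _ _ => Nat.zero_le _) (Finset.mem_univ t)

/-- Lemma 1: weight of products of block restrictions. If `p ∈ (V_n)^N` has `w ∈ L_i`
on block `r` and `v ∈ L_j` on block `s` (their sum if `r = s`) and is zero elsewhere,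
and `p ≠ 0`, then `swt p ≥ d_i`. -/
theorem gcqc_block_product_weight
    (n N m : ℕ) (hm : 1 ≤ m)
    (k : ℕ → ℕ) (hk : ∀ i, 1 ≤ i → i ≤ m → k (i + 1) < k i) (hklast : k (m + 1) = 0)
    (hkn : k 1 ≤ n)
    (S : Submodule (ZMod 2) (Pauli n))
    (hSorth : S ≤ perp (symplF n) S)
    (hSdim : Module.finrank (ZMod 2) S = n - k 1)
    (x z : ℕ → Pauli n)
    (hxS : ∀ t < k 1, x t ∈ perp (symplF n) S)
    (hzS : ∀ t < k 1, z t ∈ perp (symplF n) S)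
    (hxx : ∀ s < k 1, ∀ t < k 1, symplF n (x s) (x t) = 0)
    (hzz : ∀ s < k 1, ∀ t < k 1, symplF n (z s) (z t) = 0)
    (hxz : ∀ s < k 1, ∀ t < k 1, symplF n (x s) (z t) = if s = t then 1 else 0)
    (hdual : perp (symplF n) S = S ⊔ Lspan n x z 0 (k 1))
    (hdisj : Disjoint S (Lspan n x z 0 (k 1)))
    (d : ℕ → ℕ)
    (hd : ∀ i, 1 ≤ i → i ≤ m + 1 → ∀ v ∈ perp (symplF n) (Sstab n S z (k 1 - k i)),
      v ∉ Sstab n S z (k 1 - k i) → d i ≤ wgt v)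
    (i j : ℕ) (h1i : 1 ≤ i) (hij : i ≤ j) (hjm : j ≤ m)
    (w v : Pauli n)
    (hw : w ∈ Lspan n x z (k 1 - k i) (k 1 - k (i + 1)))
    (hv : v ∈ Lspan n x z (k 1 - k j) (k 1 - k (j + 1)))
    (r s : Fin N) (p : PauliB n N)
    (hp : p = fun t => (if t = r then w else 0) + (if t = s then v else 0))
    (hpne : p ≠ 0) :
    d i ≤ swtB p := by
  have hanti : ∀ l, i ≤ l → l ≤ m → k l ≤ k i := by
    intro l hil
    induction l, hil using Nat.le_induction with
    | base => exact fun _ => le_rfl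
    | succ l hil ih => exact fun hl => (hk l (h1i.trans hil) (by omega)).le.trans (ih (by omega))
  have hkj := hanti j hij hjm
  have hw' : w ∈ Lspan n x z (k 1 - k i) (k 1) := Lspan_mono x z le_rfl (Nat.sub_le _ _) hw
  have hv' : v ∈ Lspan n x z (k 1 - k i) (k 1) :=
    Lspan_mono x z (Nat.sub_le_sub_left hkj _) (Nat.sub_le _ _) hv
  obtain ⟨t, ht⟩ := Function.ne_iff.1 hpne
  have hpt : p t ∈ Lspan n x z (k 1 - k i) (k 1) := by
    rw [hp]
    refine Submodule.add_mem _ ?_ ?_ <;> split_ifs <;> simp [hw', hv']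
  refine (hd i h1i (by omega) (p t) (Lspan_le_perp_Sstab hxS hzS hzz hxz _ hpt)
    fun hmem => ht ?_).trans (wgt_le_swtB p t)
  exact Submodule.disjoint_def.1 (disjoint_Lspan_Sstab hxS hzS hxx hzz hxz _) _ hpt hmem
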